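/- arXiv:1805.04610 — 2 statements merged into one kernel-verified Lean document; each statement's English description precedes it below -/
import Mathlib

section
/- The Peres function Ψ is extracting: for every n, every p ∈ [0,1], and every pair of binary strings z₁, z₂ of equal length, the sum of p^{(number of 0s in x)}·(1−p)^{(number of 1s in x)} over all x ∈ {0,1}^n with Ψ(x) = z₁ equals the corresponding sum over all x ∈ {0,1}^n with Ψ(x) = z₂. -/
/-- Split a binary string into consecutive non-overlapping pairs,
    discarding a final unpaired bit. -/
def pairList : List Bool → List (Bool × Bool)
  | a :: b :: rest => (a, b) :: pairList rest
  | _ => []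

theorem two_mul_pairList_length_le : ∀ x : List Bool, 2 * (pairList x).length ≤ x.length
  | [] => by simp [pairList]
  | [_] => by simp [pairList]
  | _ :: _ :: rest => by
      have := two_mul_pairList_length_le rest
      simp [pairList]; omega

/-- The von Neumann map: Ψ₁(00) = Ψ₁(11) = λ, Ψ₁(01) = 0, Ψ₁(10) = 1. -/
def vnExt (x : List Bool) : List Bool :=
  (pairList x).filterMap fun p => if p.1 = p.2 then none else some p.1

/-- u(ab) = a XOR b, applied pairwise. -/
def uExt (x : List Bool) : List Bool :=
  (pairList x).map fun p => xor p.1 p.2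

/-- v(00) = 0, v(11) = 1, v(01) = v(10) = λ, applied pairwise. -/
def vExt (x : List Bool) : List Bool :=
  (pairList x).filterMap fun p => if p.1 = p.2 then some p.1 else none

theorem uExt_length_lt {x : List Bool} (hx : x ≠ []) : (uExt x).length < x.length := by
  have h := two_mul_pairList_length_le x
  have : x.length ≠ 0 := by simpa using List.length_eq_zero_iff.not.mpr hx
  simp only [uExt, List.length_map]
  omega

theorem vExt_length_lt {x : List Bool} (hx : x ≠ []) : (vExt x).length < x.length := by
  have h := two_mul_pairList_length_le x
  have h2 := List.length_filterMap_le
    (fun p : Bool × Bool => if p.1 = p.2 then some p.1 else none) (pairList x)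
  have : x.length ≠ 0 := by simpa using List.length_eq_zero_iff.not.mpr hx
  simp only [vExt] at *
  omega

/-- The Peres function Ψ(x) = Ψ₁(x) * Ψ(u(x)) * Ψ(v(x)), Ψ(λ) = λ. -/
def peres (x : List Bool) : List Bool :=
  if h : x = [] then [] else
    vnExt x ++ peres (uExt x) ++ peres (vExt x)
termination_by x.length
decreasing_by
  · exact uExt_length_lt h
  · exact vExt_length_lt h

/-- Probability weight of a binary string under a Bernoulli(p for 0) source. -/
noncomputable def wt (p : ℝ) (x : List Bool) : ℝ :=
  p ^ (x.count false) * (1 - p) ^ (x.count true)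

/-- The final unpaired bit of a binary string, as a string of length at most one. -/
def lastBit : List Bool → List Bool
  | _ :: _ :: rest => lastBit rest
  | x => x

/-- Reassemble a binary string from `u(x)`, `Ψ₁(x)`, `v(x)` and its final unpaired bit. -/
def unpair : List Bool → List Bool → List Bool → List Bool → List Bool
  | true :: u, a :: as, v, l => a :: (!a) :: unpair u as v l
  | false :: u, as, b :: v, l => b :: b :: unpair u as v l
  | _, _, _, l => l

theorem unpair_self : ∀ x, unpair (uExt x) (vnExt x) (vExt x) (lastBit x) = x
  | [] => rfl
  | [_] => rfl
  | a :: b :: r => by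
    have ih := unpair_self r
    cases a <;> cases b <;>
      simpa [uExt, vnExt, vExt, pairList, lastBit, unpair] using ih

theorem length_vnExt : ∀ x, (vnExt x).length = (uExt x).count true
  | [] => rfl
  | [_] => rfl
  | a :: b :: r => by
    have ih := length_vnExt r
    cases a <;> cases b <;> simpa [uExt, vnExt, pairList] using ih

theorem length_vExt : ∀ x, (vExt x).length = (uExt x).count false
  | [] => rfl
  | [_] => rfl
  | a :: b :: r => by
    have ih := length_vExt r
    cases a <;> cases b <;> simpa [uExt, vExt, pairList] using ih

theorem length_lastBit_le : ∀ x, (lastBit x).length ≤ 1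
  | [] => by simp [lastBit]
  | [_] => by simp [lastBit]
  | _ :: _ :: r => by simpa [lastBit] using length_lastBit_le r

theorem length_eq_uExt : ∀ x, x.length = 2 * (uExt x).length + (lastBit x).length
  | [] => rfl
  | [_] => rfl
  | _ :: _ :: r => by
    have ih := length_eq_uExt r
    simp [uExt, pairList, lastBit] at *
    omega

theorem count_eq_vnExt (c : Bool) : ∀ x,
    x.count c = (vnExt x).length + 2 * (vExt x).count c + (lastBit x).count c
  | [] => rfl
  | [_] => by simp [vnExt, vExt, pairList, lastBit]
  | a :: b :: r => by
    have ih := count_eq_vnExt c r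
    cases a <;> cases b <;> cases c <;> simp [vnExt, vExt, pairList, lastBit] at * <;> omega

theorem parts_unpair {l : List Bool} (hl : l.length ≤ 1) : ∀ u a v : List Bool,
    a.length = u.count true → v.length = u.count false →
    uExt (unpair u a v l) = u ∧ vnExt (unpair u a v l) = a ∧ vExt (unpair u a v l) = v ∧
      lastBit (unpair u a v l) = l := by
  intro u
  induction u with
  | nil =>
    intro a v ha hv
    obtain rfl : a = [] := by simpa using ha
    obtain rfl : v = [] := by simpa using hv
    match l, hl with
    | [], _ => simp [unpair, uExt, vnExt, vExt, pairList, lastBit]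
    | [_], _ => simp [unpair, uExt, vnExt, vExt, pairList, lastBit]
  | cons c u ih =>
    intro a v ha hv
    cases c with
    | true =>
      obtain _ | ⟨b, a⟩ := a
      · simp at ha
      · have := ih a v (by simpa using ha) (by simpa using hv)
        simp only [uExt, vnExt, vExt] at this
        simp [unpair, uExt, vnExt, vExt, pairList, lastBit, this]
    | false =>
      obtain _ | ⟨b, v⟩ := v
      · simp at hv
      · have := ih a v (by simpa using ha) (by simpa using hv)
        simp only [uExt, vnExt, vExt] at this
        simp [unpair, uExt, vnExt, vExt, pairList, lastBit, this]

/-- Bitwise XOR of a binary string with an infinite mask. -/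
def xorMask (m : ℕ → Bool) (l : List Bool) : List Bool :=
  l.mapIdx fun i b => xor (m i) b

@[simp] theorem length_xorMask (m : ℕ → Bool) (l : List Bool) :
    (xorMask m l).length = l.length := by
  simp [xorMask]

@[simp] theorem xorMask_xorMask (m : ℕ → Bool) (l : List Bool) :
    xorMask m (xorMask m l) = l := by
  apply List.ext_getElem <;> simp [xorMask]

theorem xorMask_append (m : ℕ → Bool) (l k : List Bool) :
    xorMask m (l ++ k) = xorMask m l ++ xorMask (fun i => m (i + l.length)) k := by
  simp [xorMask, List.mapIdx_append]

/-- A transformation of binary strings under which `peres` is XORed with the mask `m`. -/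
def peresXor (m : ℕ → Bool) (x : List Bool) : List Bool :=
  if h : x = [] then [] else
    unpair (peresXor (fun i => m (i + (vnExt x).length)) (uExt x)) (xorMask m (vnExt x))
      (peresXor (fun i => m (i + (vnExt x ++ peres (uExt x)).length)) (vExt x)) (lastBit x)
termination_by x.length
decreasing_by
  · exact uExt_length_lt h
  · exact vExt_length_lt h

theorem peres_eq (x : List Bool) : peres x = vnExt x ++ peres (uExt x) ++ peres (vExt x) := by
  by_cases h : x = []
  · subst h
    simp [peres, vnExt, uExt, vExt, pairList]
  · rw [peres, dif_neg h]

theorem peresXor_eq (m : ℕ → Bool) (x : List Bool) : peresXor m x =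
    unpair (peresXor (fun i => m (i + (vnExt x).length)) (uExt x)) (xorMask m (vnExt x))
      (peresXor (fun i => m (i + (vnExt x ++ peres (uExt x)).length)) (vExt x)) (lastBit x) := by
  by_cases h : x = []
  · subst h
    simp [peresXor, vnExt, uExt, vExt, pairList, lastBit, unpair, xorMask]
  · rw [peresXor, dif_neg h]

theorem peresXor_spec (m : ℕ → Bool) (x : List Bool) :
    (peresXor m x).length = x.length ∧ (∀ c, (peresXor m x).count c = x.count c) ∧
      peres (peresXor m x) = xorMask m (peres x) ∧ peresXor m (peresXor m x) = x := by
  by_cases h : x = []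
  · subst h
    simp [peresXor, peres, xorMask]
  obtain ⟨ulen, ucount, uperes, uinv⟩ :=
    peresXor_spec (fun i => m (i + (vnExt x).length)) (uExt x)
  obtain ⟨vlen, vcount, vperes, vinv⟩ :=
    peresXor_spec (fun i => m (i + (vnExt x ++ peres (uExt x)).length)) (vExt x)
  obtain ⟨hu, hvn, hv, hl⟩ := parts_unpair (length_lastBit_le x)
    (peresXor (fun i => m (i + (vnExt x).length)) (uExt x)) (xorMask m (vnExt x))
    (peresXor (fun i => m (i + (vnExt x ++ peres (uExt x)).length)) (vExt x))
    (by rw [length_xorMask, ucount, length_vnExt]) (by rw [vlen, ucount, length_vExt])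
  rw [← peresXor_eq] at hu hvn hv hl
  refine ⟨?_, fun c => ?_, ?_, ?_⟩
  · rw [length_eq_uExt, hu, hl, ulen, ← length_eq_uExt]
  · rw [count_eq_vnExt, hvn, hv, hl, vcount, length_xorMask, ← count_eq_vnExt]
  · rw [peres_eq, hu, hvn, hv, uperes, vperes, peres_eq x, xorMask_append, xorMask_append]
  · rw [peresXor_eq m (peresXor m x), hu, hvn, hv, hl, uperes]
    simp only [List.length_append, length_xorMask, xorMask_xorMask] at uinv vinv ⊢
    rw [uinv, vinv, unpair_self]
termination_by x.length
decreasing_by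
  · exact uExt_length_lt h
  · exact vExt_length_lt h

theorem ofFn_getD {l : List Bool} {n : ℕ} (h : l.length = n) :
    List.ofFn (fun i : Fin n => l.getD i false) = l := by
  subst h
  apply List.ext_getElem <;> simp

theorem exists_xorMask_eq {z₁ z₂ : List Bool} (hz : z₁.length = z₂.length) :
    ∃ m, xorMask m z₁ = z₂ := by
  refine ⟨fun i => xor (z₁.getD i false) (z₂.getD i false), ?_⟩
  apply List.ext_getElem
  · simpa using hz
  · intro i h₁ h₂
    have h : i < z₁.length := hz ▸ h₂
    simp only [xorMask, List.getElem_mapIdx, List.getD_eq_getElem _ _ h,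
      List.getD_eq_getElem _ _ h₂]
    cases z₁[i] <;> cases z₂[i] <;> rfl

/-- The Peres function Ψ is extracting. -/
theorem peres_extracting (n : ℕ) (p : ℝ) (hp : p ∈ Set.Icc (0 : ℝ) 1)
    (z₁ z₂ : List Bool) (hz : z₁.length = z₂.length) :
    (∑ x : Fin n → Bool,
        if peres (List.ofFn x) = z₁ then wt p (List.ofFn x) else 0) =
    (∑ x : Fin n → Bool,
        if peres (List.ofFn x) = z₂ then wt p (List.ofFn x) else 0) := by
  obtain ⟨m, rfl⟩ := exists_xorMask_eq hz
  have key (x : Fin n → Bool) :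
      List.ofFn (fun i : Fin n => (peresXor m (List.ofFn x)).getD i false) =
        peresXor m (List.ofFn x) :=
    ofFn_getD (by simp [(peresXor_spec m _).1])
  let f (x : Fin n → Bool) (i : Fin n) : Bool := (peresXor m (List.ofFn x)).getD i false
  have hf : Function.Involutive f := fun x => by
    apply List.ofFn_injective
    rw [key, key, (peresXor_spec m _).2.2.2]
  refine Fintype.sum_equiv hf.toPerm _ _ fun x => ?_
  have hinj : Function.Injective (xorMask m) :=
    Function.Involutive.injective (xorMask_xorMask m)
  obtain ⟨-, hcount, hperes, -⟩ := peresXor_spec m (List.ofFn x)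
  simp only [Function.Involutive.coe_toPerm, f, key, hperes, hinj.eq_iff, wt, hcount]
end

section
/- Structure lemma for the Peres binarization tree: fix n and nonnegative integers a, b, c, d with a + b + c + d = n, and let S be the set of binary strings of length 2n whose n consecutive non-overlapping pairs consist of exactly a pairs 00, b pairs 01, c pairs 10, and d pairs 11. Then the map x ↦ (Ψ₁(x), u(x), v(x)) is a bijection from S onto the Cartesian product A × B × C, where A is the set of binary strings with b zeros and c ones, B is the set of binary strings with a + d zeros and b + c ones, and C is the set of binary strings with a zeros and d ones. -/
theorem count_vnExt (e : Bool) :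
    ∀ x : List Bool, (vnExt x).count e = (pairList x).count (e, !e)
  | [] | [_] => by simp [vnExt, pairList]
  | p :: q :: x => by
      have ih := count_vnExt e x
      cases e <;> cases p <;> cases q <;> simp_all [vnExt, pairList]

theorem count_vExt (e : Bool) :
    ∀ x : List Bool, (vExt x).count e = (pairList x).count (e, e)
  | [] | [_] => by simp [vExt, pairList]
  | p :: q :: x => by
      have ih := count_vExt e x
      cases e <;> cases p <;> cases q <;> simp_all [vExt, pairList]

theorem count_uExt (e : Bool) :
    ∀ x : List Bool,
      (uExt x).count e = (pairList x).count (false, e) + (pairList x).count (true, !e)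
  | [] | [_] => by simp [uExt, pairList]
  | p :: q :: x => by
      have ih := count_uExt e x
      cases e <;> cases p <;> cases q <;> simp_all [uExt, pairList] <;> omega

/-- A string of even length is determined by its images under Ψ₁, u and v. -/
theorem eq_of_vnExt_eq_of_uExt_eq_of_vExt_eq :
    ∀ {x y : List Bool}, Even x.length → Even y.length →
      vnExt x = vnExt y → uExt x = uExt y → vExt x = vExt y → x = y
  | [], y, _, hy, _, hu, _ => by
      rcases y with _ | ⟨r, _ | ⟨s, y⟩⟩
      · rfl
      · simp at hy
      · simp [uExt, pairList] at hu
  | [_], _, hx, _, _, _, _ => by simp at hx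
  | p :: q :: x, y, hx, hy, hn, hu, hv => by
      rcases y with _ | ⟨r, _ | ⟨s, y⟩⟩
      · simp [uExt, pairList] at hu
      · simp at hy
      · have hx' : Even x.length := by simpa [Nat.even_add_one] using hx
        have hy' : Even y.length := by simpa [Nat.even_add_one] using hy
        have ih := eq_of_vnExt_eq_of_uExt_eq_of_vExt_eq hx' hy'
        simp only [vnExt, uExt, vExt, pairList, List.filterMap_cons, List.map_cons,
          List.cons.injEq] at ih hn hu hv ⊢
        cases p <;> cases q <;> cases r <;> cases s <;> simp at hn hu hv ⊢ <;> grind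

/-- Strings with compatible lengths are jointly the images of some string under Ψ₁, u and v. -/
theorem exists_vnExt_eq_uExt_eq_vExt_eq :
    ∀ y u v : List Bool, y.length = u.count true → v.length = u.count false →
      ∃ x : List Bool, x.length = 2 * u.length ∧ vnExt x = y ∧ uExt x = u ∧ vExt x = v
  | y, [], v, hy, hv => ⟨[], by simp_all [vnExt, uExt, vExt, pairList]⟩
  | [], true :: _, _, hy, _ => by simp at hy
  | _, false :: _, [], _, hv => by simp at hv
  | e :: y, true :: u, v, hy, hv => by
      obtain ⟨x, hl, rfl, rfl, rfl⟩ :=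
        exists_vnExt_eq_uExt_eq_vExt_eq y u v (by simpa using hy) (by simpa using hv)
      refine ⟨e :: (!e) :: x, ?_⟩
      cases e <;> simp [vnExt, uExt, vExt, pairList] at hl ⊢ <;> omega
  | y, false :: u, e :: v, hy, hv => by
      obtain ⟨x, hl, rfl, rfl, rfl⟩ :=
        exists_vnExt_eq_uExt_eq_vExt_eq y u v (by simpa using hy) (by simpa using hv)
      refine ⟨e :: e :: x, ?_⟩
      cases e <;> simp [vnExt, uExt, vExt, pairList] at hl ⊢ <;> omega

/-- Structure lemma for the Peres binarization tree: on the equiprobable set of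
strings of length 2n with a pairs 00, b pairs 01, c pairs 10 and d pairs 11,
the map x ↦ (Ψ₁(x), u(x), v(x)) is a bijection onto A × B × C. -/
theorem peres_structure_lemma (n a b c d : ℕ) (h : a + b + c + d = n) :
    Set.BijOn (fun x => (vnExt x, uExt x, vExt x))
      {x : List Bool | x.length = 2 * n ∧
        (pairList x).count (false, false) = a ∧
        (pairList x).count (false, true) = b ∧
        (pairList x).count (true, false) = c ∧
        (pairList x).count (true, true) = d}
      (({y : List Bool | y.count false = b ∧ y.count true = c}) ×ˢ
       ({y : List Bool | y.count false = a + d ∧ y.count true = b + c}) ×ˢ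
       ({y : List Bool | y.count false = a ∧ y.count true = d})) := by
  refine ⟨?_, ?_, ?_⟩
  · rintro x ⟨-, rfl, rfl, rfl, rfl⟩
    simp [count_vnExt, count_uExt, count_vExt]
  · rintro x ⟨hx, -⟩ y ⟨hy, -⟩ hxy
    simp only [Prod.mk.injEq] at hxy
    exact eq_of_vnExt_eq_of_uExt_eq_of_vExt_eq (hx ▸ even_two_mul n) (hy ▸ even_two_mul n)
      hxy.1 hxy.2.1 hxy.2.2
  · rintro ⟨y, u, v⟩ ⟨⟨hy₀, hy₁⟩, ⟨hu₀, hu₁⟩, ⟨hv₀, hv₁⟩⟩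
    dsimp only at hy₀ hy₁ hu₀ hu₁ hv₀ hv₁
    have hy := List.count_false_add_count_true y
    have hu := List.count_false_add_count_true u
    have hv := List.count_false_add_count_true v
    obtain ⟨x, hx, rfl, rfl, rfl⟩ :=
      exists_vnExt_eq_uExt_eq_vExt_eq y u v (by omega) (by omega)
    rw [count_vnExt] at hy₀ hy₁
    rw [count_vExt] at hv₀ hv₁
    exact ⟨x, ⟨by omega, hv₀, hy₀, hy₁, hv₁⟩, rfl⟩
end
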